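/- arXiv:1903.06710 — 2 statements merged into one kernel-verified Lean document; each statement's English description precedes it below -/
import Mathlib

section
/- Let F_N(θ) := Σ_{|j| ≤ N} (1 − |j|/(N+1)) exp(ijθ) denote the Fejér kernel. For every ξ ∈ H and every N ∈ ℕ, the H-valued Bochner integral (1/(2π)²)·∫₀^{2π}∫₀^{2π} F_N(θ₁)·F_N(θ₂)·ρ_{θ₁,θ₂}ξ dθ₁ dθ₂ equals the finite sum Σ_{|k| ≤ N, |l| ≤ N} (1 − |k|/(N+1))·(1 − |l|/(N+1))·⟪ξ, e^{kl}⟫·e^{kl}. -/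
open MeasureTheory AddCircle Complex

noncomputable section

instance : Fact ((0:ℝ) < 2 * Real.pi) := ⟨by positivity⟩

/-- The normalized Haar probability measure on `𝕋 = ℝ/2πℤ`. -/
abbrev m2pi : Measure (AddCircle (2 * Real.pi)) := @haarAddCircle (2 * Real.pi) _

/-- The Hilbert space `H = ℓ²(ℤ; L²(𝕋, m))`. -/
abbrev H : Type := lp (fun _ : ℤ => Lp ℂ 2 m2pi) 2

/-- The vector `e^{kl} ∈ H` whose `n`-th component is `θ ↦ exp (i l θ)` if `n = k`
and `0` otherwise. -/
def e (k l : ℤ) : H := lp.single 2 k (fourierLp 2 l)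

/-- `IsRho θ₁ θ₂ ρ` says that `ρ : H → H` is given componentwise by
`(ρ ξ)_n(θ) = exp (i n θ₂) · ξ_n(θ + θ₁)`. -/
def IsRho (θ₁ θ₂ : ℝ) (ρ : H → H) : Prop :=
  ∀ (ξ : H) (n : ℤ),
    (ρ ξ n : AddCircle (2 * Real.pi) → ℂ) =ᵐ[m2pi]
      fun θ => Complex.exp (Complex.I * n * θ₂) * (ξ n (θ + (θ₁ : AddCircle (2 * Real.pi))))

/-- The Fejér kernel `F_N(θ) = ∑_{|j| ≤ N} (1 - |j|/(N+1)) exp (i j θ)`. -/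
def fejer (N : ℕ) (θ : ℝ) : ℂ :=
  ∑ j ∈ Finset.Icc (-(N:ℤ)) (N:ℤ), (1 - ((|j| : ℤ) : ℂ) / (N + 1)) * Complex.exp (Complex.I * j * θ)


lemma mp_add (a : AddCircle (2 * Real.pi)) : MeasurePreserving (fun x => x + a) m2pi m2pi :=
  measurePreserving_add_right _ a

/-- Translation on `L²(𝕋)`. -/
def Tr (a : AddCircle (2 * Real.pi)) : Lp ℂ 2 m2pi →ₗᵢ[ℂ] Lp ℂ 2 m2pi :=
  Lp.compMeasurePreservingₗᵢ ℂ (fun x => x + a) (mp_add a)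

lemma Tr_coe (a : AddCircle (2 * Real.pi)) (f : Lp ℂ 2 m2pi) :
    (Tr a f : AddCircle (2 * Real.pi) → ℂ) =ᵐ[m2pi] fun x => f (x + a) :=
  Lp.coeFn_compMeasurePreserving f (mp_add a)

lemma Tr_cont (f : Lp ℂ 2 m2pi) : Continuous fun a => Tr a f := by
  have hg : Continuous (fun a : AddCircle (2 * Real.pi) =>
      (⟨fun x => x + a, by fun_prop⟩ : C(AddCircle (2 * Real.pi), AddCircle (2 * Real.pi)))) := by
    apply ContinuousMap.continuous_of_continuous_uncurry
    simp only [Function.uncurry_def, ContinuousMap.coe_mk]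
    fun_prop
  exact Continuous.compMeasurePreservingLp (μ := m2pi) (ν := m2pi) (p := 2)
    (continuous_const (y := f)) hg (fun a => mp_add a) (by simp)

lemma rho_comp {θ₁ θ₂ : ℝ} {r : H → H} (h : IsRho θ₁ θ₂ r) (ξ : H) (n : ℤ) :
    r ξ n = Complex.exp (Complex.I * n * θ₂) • Tr (θ₁ : AddCircle (2 * Real.pi)) (ξ n) := by
  apply Lp.ext
  filter_upwards [h ξ n, Lp.coeFn_smul (Complex.exp (Complex.I * n * θ₂))
    (Tr (θ₁ : AddCircle (2 * Real.pi)) (ξ n)), Tr_coe (θ₁ : AddCircle (2 * Real.pi)) (ξ n)]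
    with x h1 h2 h3
  rw [h1, h2, Pi.smul_apply, h3, smul_eq_mul]

lemma norm_exp_aux (n : ℤ) (θ : ℝ) : ‖Complex.exp (Complex.I * n * θ)‖ = 1 := by
  rw [Complex.norm_exp]; simp

lemma rho_norm {θ₁ θ₂ : ℝ} {r : H → H} (h : IsRho θ₁ θ₂ r) (ξ η : H) :
    ‖r ξ - r η‖ = ‖ξ - η‖ := by
  rw [lp.norm_eq_tsum_rpow (by simp), lp.norm_eq_tsum_rpow (by simp)]
  congr 2
  ext n
  rw [lp.coeFn_sub, lp.coeFn_sub, Pi.sub_apply, Pi.sub_apply, rho_comp h, rho_comp h,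
    ← smul_sub, ← map_sub, norm_smul, norm_exp_aux, one_mul, LinearIsometry.norm_map]

lemma rho_sum {θ₁ θ₂ : ℝ} {r : H → H} (h : IsRho θ₁ θ₂ r) (ξ : H) (s : Finset ℤ) :
    r (∑ k ∈ s, lp.single 2 k (ξ k)) = ∑ k ∈ s, lp.single 2 k
      (Complex.exp (Complex.I * k * θ₂) • Tr (θ₁ : AddCircle (2 * Real.pi)) (ξ k)) := by
  ext1
  funext n
  rw [rho_comp h]
  simp only [lp.coeFn_sum, lp.coeFn_single, Finset.sum_apply, Finset.sum_pi_single]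
  split_ifs <;> simp

lemma rho_cont (ρ : ℝ → ℝ → H → H)
    (hρ : ∀ θ₁ θ₂ : ℝ, IsRho θ₁ θ₂ (ρ θ₁ θ₂)) (ξ : H) :
    Continuous (fun p : ℝ × ℝ => ρ p.1 p.2 ξ) := by
  have hu : TendstoUniformly (fun (s : Finset ℤ) (p : ℝ × ℝ) =>
      ρ p.1 p.2 (∑ k ∈ s, lp.single 2 k (ξ k))) (fun p => ρ p.1 p.2 ξ) Filter.atTop := by
    rw [Metric.tendstoUniformly_iff]
    intro ε hε
    have h := lp.hasSum_single (p := 2) (by simp) ξ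
    filter_upwards [Metric.tendsto_nhds.1 h ε hε] with s hs p
    rw [dist_comm, dist_eq_norm, rho_norm (hρ _ _), ← dist_eq_norm]
    exact hs
  refine hu.continuous (Filter.Eventually.of_forall fun s => ?_).frequently
  simp_rw [fun p : ℝ × ℝ => rho_sum (hρ p.1 p.2) ξ s]
  refine continuous_finsetSum _ fun k _ => ?_
  refine (lp.isometry_single k).continuous.comp ?_
  have h1 : Continuous fun p : ℝ × ℝ => Complex.exp (Complex.I * k * p.2) := by fun_prop
  refine h1.smul ?_
  exact (Tr_cont (ξ k)).comp ((AddCircle.continuous_mk' _).comp continuous_fst)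

lemma inner_Tr (l : ℤ) (θ : ℝ) (f : Lp ℂ 2 m2pi) :
    inner ℂ (fourierLp 2 l : Lp ℂ 2 m2pi) (Tr (θ : AddCircle (2 * Real.pi)) f) =
      Complex.exp (Complex.I * l * θ) * inner ℂ (fourierLp 2 l : Lp ℂ 2 m2pi) f := by
  have key : Tr (θ : AddCircle (2 * Real.pi)) (fourierLp 2 l) =
      Complex.exp (Complex.I * l * θ) • (fourierLp 2 l : Lp ℂ 2 m2pi) := by
    apply Lp.ext
    have h0 := coeFn_fourierLp (T := 2 * Real.pi) 2 l
    filter_upwards [Tr_coe (θ : AddCircle (2 * Real.pi)) (fourierLp 2 l), h0,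
      (mp_add (θ : AddCircle (2 * Real.pi))).quasiMeasurePreserving.ae_eq_comp h0,
      Lp.coeFn_smul (Complex.exp (Complex.I * l * θ)) (fourierLp 2 l : Lp ℂ 2 m2pi)]
      with x h1 h2 h3 h4
    simp only [Function.comp_apply] at h3
    rw [h1, h4, h3, Pi.smul_apply, h2, smul_eq_mul]
    have : (fourier l : C(AddCircle (2 * Real.pi), ℂ)) (θ : AddCircle (2 * Real.pi)) =
        Complex.exp (Complex.I * l * θ) := by
      rw [fourier_coe_apply]
      congr 1
      have : (Real.pi : ℂ) ≠ 0 := by exact_mod_cast Real.pi_ne_zero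
      push_cast
      field_simp
    rw [← this]
    simp only [fourier_apply, smul_add, toCircle_add, Circle.coe_mul]
    ring
  have h2 := (Tr (θ : AddCircle (2 * Real.pi))).inner_map_map (fourierLp 2 l) f
  rw [key, inner_smul_left] at h2
  rw [← h2, ← mul_assoc, Complex.mul_conj, Complex.normSq_eq_norm_sq, norm_exp_aux]
  simp

lemma inner_e (k l : ℤ) (x : H) :
    inner ℂ (e k l) x = inner ℂ (fourierLp 2 l : Lp ℂ 2 m2pi) (x k) :=
  lp.inner_single_left _ _ _

lemma inner_e_rho {θ₁ θ₂ : ℝ} {r : H → H} (h : IsRho θ₁ θ₂ r) (ξ : H) (k l : ℤ) :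
    inner ℂ (e k l) (r ξ) = Complex.exp (Complex.I * k * θ₂) *
      (Complex.exp (Complex.I * l * θ₁) * inner ℂ (e k l) ξ) := by
  rw [inner_e, inner_e, rho_comp h, inner_smul_right, inner_Tr]

lemma inner_e_e (k l k' l' : ℤ) :
    inner ℂ (e k l) (e k' l') = if k = k' then (if l = l' then (1 : ℂ) else 0) else 0 := by
  rw [inner_e]
  unfold e
  rw [lp.single_apply]
  by_cases h : k = k'
  · subst h
    rw [Pi.single_eq_same, if_pos rfl]
    exact orthonormal_iff_ite.1 (orthonormal_fourier (T := 2 * Real.pi)) l l'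
  · rw [Pi.single_eq_of_ne h, inner_zero_right, if_neg h]

lemma ext_e {x y : H} (h : ∀ k l, inner ℂ (e k l) x = inner ℂ (e k l) y) : x = y := by
  ext1
  funext k
  apply (fourierBasis (T := 2 * Real.pi)).repr.injective
  ext l
  rw [HilbertBasis.repr_apply_apply, HilbertBasis.repr_apply_apply, coe_fourierBasis,
    ← inner_e, ← inner_e]
  exact h k l

lemma integral_exp_aux (n : ℤ) :
    ∫ θ in (0:ℝ)..(2 * Real.pi), Complex.exp (Complex.I * n * θ) =
      if n = 0 then (2 * Real.pi : ℂ) else 0 := by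
  split_ifs with h
  · subst h; simp
  · have hn : (Complex.I * n : ℂ) ≠ 0 := mul_ne_zero Complex.I_ne_zero (by exact_mod_cast h)
    rw [integral_exp_mul_complex hn]
    have : Complex.I * n * ((2 * Real.pi : ℝ) : ℂ) = n * (2 * Real.pi * Complex.I) := by
      push_cast; ring
    rw [this, Complex.exp_int_mul_two_pi_mul_I]
    simp

lemma real_smul_aux (r : ℝ) (x : H) : r • x = (r : ℂ) • x := by
  ext1
  funext n
  apply Lp.ext
  rw [lp.coeFn_smul, lp.coeFn_smul, Pi.smul_apply, Pi.smul_apply]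
  filter_upwards [Lp.coeFn_smul r (x n), Lp.coeFn_smul (r : ℂ) (x n)] with t h1 h2
  rw [h1, h2, Pi.smul_apply, Pi.smul_apply, Complex.real_smul, smul_eq_mul]

/-- Fejér coefficients. -/
def fc (N : ℕ) (k : ℤ) : ℂ :=
  if k ∈ Finset.Icc (-(N:ℤ)) (N:ℤ) then (1 - ((|k| : ℤ) : ℂ) / (N + 1)) else 0

lemma fejer_cont (N : ℕ) : Continuous (fejer N) := by
  unfold fejer
  fun_prop

lemma integral_fejer (N : ℕ) (k : ℤ) :
    ∫ θ in (0:ℝ)..(2 * Real.pi), fejer N θ * Complex.exp (Complex.I * k * θ) =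
      2 * Real.pi * fc N k := by
  have : ∀ θ : ℝ, fejer N θ * Complex.exp (Complex.I * k * θ) =
      ∑ j ∈ Finset.Icc (-(N:ℤ)) (N:ℤ), (1 - ((|j| : ℤ) : ℂ) / (N + 1)) *
        Complex.exp (Complex.I * ((j + k : ℤ) : ℂ) * θ) := by
    intro θ
    rw [fejer, Finset.sum_mul]
    refine Finset.sum_congr rfl fun j _ => ?_
    rw [mul_assoc, ← Complex.exp_add]
    congr 2
    push_cast; ring
  simp_rw [this]
  rw [intervalIntegral.integral_finsetSum
    (fun j _ => Continuous.intervalIntegrable (by fun_prop) _ _)]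
  simp_rw [intervalIntegral.integral_const_mul, integral_exp_aux]
  have h2 : ∀ j : ℤ, (j + k = 0) = (j = -k) := fun j => by
    rw [add_eq_zero_iff_eq_neg]
  simp_rw [h2, mul_ite, mul_zero]
  rw [Finset.sum_ite_eq', fc]
  have h3 : (-k ∈ Finset.Icc (-(N:ℤ)) (N:ℤ)) ↔ (k ∈ Finset.Icc (-(N:ℤ)) (N:ℤ)) := by
    simp only [Finset.mem_Icc]; omega
  simp only [h3, abs_neg, mul_ite, mul_zero]
  split_ifs
  · ring
  · rfl

/-- The transference identity: the Bochner integral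
`(1/(2π)²) ∫₀^{2π}∫₀^{2π} F_N(θ₁) F_N(θ₂) ρ_{θ₁,θ₂} ξ dθ₁ dθ₂` equals the double Cesàro mean
`∑_{|k|,|l| ≤ N} (1 - |k|/(N+1))(1 - |l|/(N+1)) ⟪ξ, e^{kl}⟫ e^{kl}`.
(The pairing `⟪ξ, e^{kl}⟫`, linear in `ξ`, is `inner (e k l) ξ` in Mathlib's convention.) -/
theorem fejer_transference (ρ : ℝ → ℝ → H → H)
    (hρ : ∀ θ₁ θ₂ : ℝ, IsRho θ₁ θ₂ (ρ θ₁ θ₂)) (ξ : H) (N : ℕ) :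
    (1 / (2 * Real.pi) ^ 2) •
        (∫ θ₁ in (0:ℝ)..(2 * Real.pi), ∫ θ₂ in (0:ℝ)..(2 * Real.pi),
          (fejer N θ₁ * fejer N θ₂) • ρ θ₁ θ₂ ξ) =
      ∑ k ∈ Finset.Icc (-(N:ℤ)) (N:ℤ), ∑ l ∈ Finset.Icc (-(N:ℤ)) (N:ℤ),
        ((1 - ((|k| : ℤ) : ℂ) / (N + 1)) * (1 - ((|l| : ℤ) : ℂ) / (N + 1)) *
          inner (𝕜 := ℂ) (e k l) ξ) • e k l := by
  have hF := fejer_cont N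
  have hR := rho_cont ρ hρ ξ
  have hc : Continuous (fun p : ℝ × ℝ => (fejer N p.1 * fejer N p.2) • ρ p.1 p.2 ξ) :=
    Continuous.smul ((hF.comp continuous_fst).mul (hF.comp continuous_snd)) hR
  have hc1 : ∀ θ₁ : ℝ, Continuous fun θ₂ => (fejer N θ₁ * fejer N θ₂) • ρ θ₁ θ₂ ξ := fun θ₁ =>
    Continuous.smul (continuous_const.mul hF)
      (hR.comp (g := fun p : ℝ × ℝ => ρ p.1 p.2 ξ) (Continuous.prodMk_right θ₁))
  have hc2 : Continuous fun θ₁ => ∫ θ₂ in (0:ℝ)..(2 * Real.pi),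
      (fejer N θ₁ * fejer N θ₂) • ρ θ₁ θ₂ ξ :=
    intervalIntegral.continuous_parametric_intervalIntegral_of_continuous'
      (f := fun θ₁ θ₂ => (fejer N θ₁ * fejer N θ₂) • ρ θ₁ θ₂ ξ) hc _ _
  apply ext_e
  intro k l
  have hL : inner ℂ (e k l) (∫ θ₁ in (0:ℝ)..(2 * Real.pi), ∫ θ₂ in (0:ℝ)..(2 * Real.pi),
          (fejer N θ₁ * fejer N θ₂) • ρ θ₁ θ₂ ξ) =
      (2 * Real.pi * fc N l) * (2 * Real.pi * fc N k) * inner ℂ (e k l) ξ := by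
    rw [← innerSL_apply_apply ℂ (e k l), ← ContinuousLinearMap.intervalIntegral_comp_comm _
      (hc2.intervalIntegrable _ _)]
    have : ∀ θ₁ : ℝ, innerSL ℂ (e k l) (∫ θ₂ in (0:ℝ)..(2 * Real.pi),
        (fejer N θ₁ * fejer N θ₂) • ρ θ₁ θ₂ ξ) =
        (fejer N θ₁ * Complex.exp (Complex.I * l * θ₁)) *
          ((2 * Real.pi * fc N k) * inner ℂ (e k l) ξ) := by
      intro θ₁
      rw [← ContinuousLinearMap.intervalIntegral_comp_comm _ ((hc1 θ₁).intervalIntegrable _ _),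
        ← integral_fejer, ← intervalIntegral.integral_mul_const,
        ← intervalIntegral.integral_const_mul]
      congr 1
      funext θ₂
      rw [innerSL_apply_apply, inner_smul_right, inner_e_rho (hρ _ _)]
      ring
    simp_rw [this]
    rw [intervalIntegral.integral_mul_const, integral_fejer]
    ring
  rw [real_smul_aux, inner_smul_right, hL]
  simp_rw [inner_sum, inner_smul_right, inner_e_e, mul_ite, mul_one, mul_zero]
  have hp : (Real.pi : ℂ) ≠ 0 := by exact_mod_cast Real.pi_ne_zero
  have hs : ∀ k' : ℤ, (∑ l' ∈ Finset.Icc (-(N:ℤ)) (N:ℤ), if k = k' then (if l = l' then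
      (1 - ((|k'| : ℤ) : ℂ) / (N + 1)) * (1 - ((|l'| : ℤ) : ℂ) / (N + 1)) *
          inner (𝕜 := ℂ) (e k' l') ξ else 0) else 0) = if k = k' then
      (1 - ((|k'| : ℤ) : ℂ) / (N + 1)) * fc N l * inner (𝕜 := ℂ) (e k' l) ξ else 0 := by
    intro k'
    split_ifs
    · rw [Finset.sum_ite_eq, fc]
      split_ifs <;> simp
    · simp
  simp_rw [hs]
  rw [Finset.sum_ite_eq]
  rw [fc, fc]
  push_cast
  split_ifs <;> field_simp <;> simp

end
end

section
/- Let (Γ_n)_{n ≥ 1} be a sequence of real numbers with Γ_n ≥ 1 for all n. If Γ_n / log n → 0 as n → ∞, then Γ_n / (Σ_{l=1}^{n} 1/Γ_l) → 0 as n → ∞. -/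
open Filter

/-- If `Γₙ ≥ 1` and `Γₙ / log n → 0`, then `Γₙ / (∑_{l=1}^n 1/Γₗ) → 0`. -/
theorem growth_ratio_tendsto_zero (Γ : ℕ → ℝ) (hΓ : ∀ n, 1 ≤ n → 1 ≤ Γ n)
    (h : Tendsto (fun n => Γ n / Real.log n) atTop (nhds 0)) :
    Tendsto (fun n => Γ n / (∑ l ∈ Finset.Icc 1 n, 1 / Γ l)) atTop (nhds 0) := by
  have hlim : Tendsto (fun n : ℕ => 2 * (Real.log n ^ 2 / (n : ℝ))) atTop (nhds 0) := by
    have h1 := (Real.isLittleO_pow_log_id_atTop (n := 2)).tendsto_div_nhds_zero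
    have h2 := (h1.comp (tendsto_natCast_atTop_atTop (R := ℝ))).const_mul 2
    simpa [Function.comp_def] using h2
  obtain ⟨N₀, hN₀⟩ := eventually_atTop.1 (h.eventually (gt_mem_nhds (zero_lt_one)))
  obtain ⟨N, hN2, hN⟩ : ∃ N : ℕ, 2 ≤ N ∧ ∀ n, N ≤ n → Γ n ≤ Real.log n := by
    refine ⟨max N₀ 2, le_max_right _ _, fun n hn => ?_⟩
    have hn0 := hN₀ n (le_trans (le_max_left _ _) hn)
    have hn2 : 2 ≤ n := le_trans (le_max_right _ _) hn
    have hl : 0 < Real.log n := Real.log_pos (by exact_mod_cast hn2)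
    rw [div_lt_one hl] at hn0
    exact hn0.le
  have hpos : ∀ n, 1 ≤ n → 0 < Γ n := fun n hn => lt_of_lt_of_le one_pos (hΓ n hn)
  refine tendsto_of_tendsto_of_tendsto_of_le_of_le' tendsto_const_nhds hlim ?_ ?_
  · filter_upwards [eventually_ge_atTop 1] with n hn
    refine div_nonneg (hpos n hn).le (Finset.sum_nonneg fun l hl => ?_)
    exact (one_div_pos.2 (hpos l (Finset.mem_Icc.1 hl).1)).le
  · filter_upwards [eventually_ge_atTop (2 * N)] with n hn
    have hn2 : 2 ≤ n := by omega
    have hl : 0 < Real.log n := Real.log_pos (by exact_mod_cast hn2)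
    have hnp : (0 : ℝ) < n := by exact_mod_cast (by omega : 0 < n)
    have hS : (n : ℝ) / (2 * Real.log n) ≤ ∑ l ∈ Finset.Icc 1 n, 1 / Γ l := by
      calc (n : ℝ) / (2 * Real.log n) = (n / 2) * (1 / Real.log n) := by field_simp
        _ ≤ ((Finset.Icc N n).card : ℝ) * (1 / Real.log n) := by
          gcongr
          rw [Nat.card_Icc, div_le_iff₀ two_pos]
          exact_mod_cast (by omega : n ≤ (n + 1 - N) * 2)
        _ = ∑ l ∈ Finset.Icc N n, 1 / Real.log n := by simp
        _ ≤ ∑ l ∈ Finset.Icc N n, 1 / Γ l := by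
          refine Finset.sum_le_sum fun l hl' => ?_
          obtain ⟨h1, h2⟩ := Finset.mem_Icc.1 hl'
          refine one_div_le_one_div_of_le (hpos l (by omega)) ((hN l h1).trans ?_)
          exact Real.log_le_log (by exact_mod_cast (by omega : 0 < l)) (by exact_mod_cast h2)
        _ ≤ ∑ l ∈ Finset.Icc 1 n, 1 / Γ l := by
          refine Finset.sum_le_sum_of_subset_of_nonneg
            (Finset.Icc_subset_Icc_left (by omega)) fun l hl' _ => ?_
          exact (one_div_pos.2 (hpos l (Finset.mem_Icc.1 hl').1)).le
    calc Γ n / (∑ l ∈ Finset.Icc 1 n, 1 / Γ l)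
        ≤ Real.log n / ((n : ℝ) / (2 * Real.log n)) :=
          div_le_div₀ hl.le (hN n (by omega)) (by positivity) hS
      _ = 2 * (Real.log n ^ 2 / (n : ℝ)) := by field_simp
end
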